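/- For all m and all n with 1 ≤ n ≤ m/900, every non-adaptive (m,n,s,3)-scheme in which every query function equals the function (x,y,z) ↦ 1 iff x+y+z = 1 (where x,y,z ∈ {0,1} and the sum is over the integers) satisfies s ≥ (3/(5e))·√(mn). In particular s_N(m,n,3) = Ω(√(mn)) for this query function. -/

import Mathlib

/-- The monomial function attached to a set `A` of cells, on an index type `P` of stored strings. -/
def monoFn {P : Type} {s : ℕ} (ψ : P → Fin s → Bool) (A : Finset (Fin s)) : P → ZMod 3 :=
  fun p => ∏ j ∈ A, ((ψ p j).toNat : ZMod 3)

open Classical in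
/-- Span of monomials of degree at most `d`. -/
noncomputable def degSpan {P : Type} {s : ℕ} (ψ : P → Fin s → Bool) (d : ℕ) : Submodule (ZMod 3) (P → ZMod 3) :=
  Submodule.span (ZMod 3)
    (((Finset.univ.filter (fun A : Finset (Fin s) => A.card ≤ d)).image (monoFn ψ) :
      Finset (P → ZMod 3)) : Set (P → ZMod 3))

lemma monoFn_mul {P : Type} {s : ℕ} (ψ : P → Fin s → Bool) (A B : Finset (Fin s)) :
    monoFn ψ A * monoFn ψ B = monoFn ψ (A ∪ B) := by
  classical
  funext p
  have key : ∀ A : Finset (Fin s), monoFn ψ A p = if ∀ j ∈ A, ψ p j = true then 1 else 0 := by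
    intro A
    unfold monoFn
    split_ifs with h
    · exact Finset.prod_eq_one fun j hj => by simp [h j hj]
    · push Not at h
      obtain ⟨j, hj, hj'⟩ := h
      refine Finset.prod_eq_zero hj ?_
      simp at hj'
      simp [hj']
  rw [Pi.mul_apply, key, key, key]
  by_cases hA : ∀ j ∈ A, ψ p j = true <;> by_cases hB : ∀ j ∈ B, ψ p j = true
  · rw [if_pos hA, if_pos hB, if_pos]
    · simp
    · intro j hj
      rcases Finset.mem_union.1 hj with h | h
      · exact hA j h
      · exact hB j h
  · rw [if_neg hB, if_neg (c := ∀ j ∈ A ∪ B, _)]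
    · simp
    · exact fun h => hB fun j hj => h j (Finset.mem_union_right _ hj)
  · rw [if_neg hA, if_neg (c := ∀ j ∈ A ∪ B, _)]
    · simp
    · exact fun h => hA fun j hj => h j (Finset.mem_union_left _ hj)
  · rw [if_neg hA, if_neg (c := ∀ j ∈ A ∪ B, _)]
    · simp
    · exact fun h => hA fun j hj => h j (Finset.mem_union_left _ hj)

lemma monoFn_mem {P : Type} {s : ℕ} (ψ : P → Fin s → Bool) (d : ℕ) (A : Finset (Fin s))
    (h : A.card ≤ d) : monoFn ψ A ∈ degSpan ψ d := by
  refine Submodule.subset_span ?_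
  simp only [Finset.coe_image, Set.mem_image]
  exact ⟨A, by simpa using h, rfl⟩

lemma degSpan_mul {P : Type} {s : ℕ} (ψ : P → Fin s → Bool) (a b : ℕ) (f g : P → ZMod 3)
    (hf : f ∈ degSpan ψ a) (hg : g ∈ degSpan ψ b) : f * g ∈ degSpan ψ (a + b) := by
  have h : degSpan ψ a * degSpan ψ b ≤ degSpan ψ (a + b) := by
    unfold degSpan
    rw [Submodule.span_mul_span, Submodule.span_le]
    rintro _ ⟨f, hf, g, hg, rfl⟩
    simp only [Finset.coe_image, Set.mem_image] at hf hg
    obtain ⟨A, hA, rfl⟩ := hf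
    obtain ⟨B, hB, rfl⟩ := hg
    simp at hA hB
    simp only [monoFn_mul]
    exact monoFn_mem ψ (a + b) _ ((Finset.card_union_le _ _).trans (by omega))
  exact h (Submodule.mul_mem_mul hf hg)

lemma choose_le_count (m n s : ℕ) (i₁ i₂ i₃ : Fin m → Fin s) (φ : Finset (Fin m) → Fin s → Bool)
    (H : ∀ S : Finset (Fin m), S.card ≤ n → ∀ x : Fin m,
        (((φ S (i₁ x)).toNat + (φ S (i₂ x)).toNat + (φ S (i₃ x)).toNat = 1) ↔ x ∈ S)) :
    m.choose n ≤ (Finset.univ.filter (fun A : Finset (Fin s) => A.card ≤ 2 * n)).card := by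
  classical
  let P := {S : Finset (Fin m) // S.card = n}
  let ψ : P → Fin s → Bool := fun p => φ p.1
  let T : Fin m → P → ZMod 3 := fun x =>
    monoFn ψ {i₁ x} + monoFn ψ {i₂ x} + monoFn ψ {i₃ x}
  let g : Fin m → P → ZMod 3 := fun x => T x * ((2 : ZMod 3) • monoFn ψ ∅ - T x)
  have hT : ∀ x, T x ∈ degSpan ψ 1 := fun x =>
    add_mem (add_mem (monoFn_mem ψ _ _ (by simp)) (monoFn_mem ψ _ _ (by simp)))
      (monoFn_mem ψ _ _ (by simp))
  have hg : ∀ x, g x ∈ degSpan ψ 2 := fun x =>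
    degSpan_mul ψ 1 1 _ _ (hT x)
      (sub_mem (Submodule.smul_mem _ _ (monoFn_mem ψ _ _ (by simp))) (hT x))
  have hgv : ∀ x (p : P), g x p = if x ∈ p.1 then 1 else 0 := by
    intro x p
    have h := H p.1 p.2.le x
    simp only [← h]
    simp only [g, T, ψ, monoFn, Pi.mul_apply, Pi.add_apply, Pi.sub_apply, Pi.smul_apply,
      Finset.prod_singleton, Finset.prod_empty]
    generalize φ p.1 (i₁ x) = a
    generalize φ p.1 (i₂ x) = b
    generalize φ p.1 (i₃ x) = c
    revert a b c
    decide
  have hprod : ∀ S : Finset (Fin m), (∏ x ∈ S, g x) ∈ degSpan ψ (2 * S.card) := by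
    intro S
    induction S using Finset.induction_on with
    | empty =>
      have : (∏ x ∈ (∅ : Finset (Fin m)), g x) = monoFn ψ ∅ := by
        funext p; simp [monoFn]
      rw [this]
      exact monoFn_mem ψ _ _ (by simp)
    | insert a S ha ih =>
      rw [Finset.prod_insert ha, Finset.card_insert_of_notMem ha]
      have := degSpan_mul ψ 2 (2 * S.card) _ _ (hg a) ih
      convert this using 2
      ring
  have hsingle : ∀ p : P, (Pi.single p (1 : ZMod 3) : P → ZMod 3) ∈ degSpan ψ (2 * n) := by
    intro p
    have h1 := hprod p.1
    rw [p.2] at h1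
    convert h1 using 1
    funext q
    rw [Finset.prod_apply]
    simp only [hgv]
    by_cases hpq : q = p
    · subst hpq
      rw [Pi.single_eq_same]
      exact (Finset.prod_eq_one fun x hx => by simp [hx]).symm
    · rw [Pi.single_eq_of_ne hpq]
      have : ¬ p.1 ⊆ q.1 := fun hs =>
        hpq (Subtype.ext (Finset.eq_of_subset_of_card_le hs (by rw [p.2, q.2])).symm)
      obtain ⟨x, hx, hx'⟩ := Finset.not_subset.1 this
      exact (Finset.prod_eq_zero hx (by simp [hx'])).symm
  have htop : degSpan ψ (2 * n) = ⊤ := by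
    rw [eq_top_iff]
    intro f _
    rw [pi_eq_sum_univ' f]
    refine Submodule.sum_mem _ fun p _ => Submodule.smul_mem _ _ ?_
    convert hsingle p using 1
  have hcard : Fintype.card P = m.choose n := by
    simp [P]
  have : Fact (Nat.Prime 3) := ⟨Nat.prime_three⟩
  have h1 : Module.finrank (ZMod 3) (degSpan ψ (2 * n)) = m.choose n := by
    rw [htop, finrank_top, Module.finrank_fintype_fun_eq_card, hcard]
  rw [← h1]
  exact (finrank_span_finset_le_card _).trans (@Finset.card_image_le _ _ _ _ (_))

lemma count_bound (s d : ℕ) (t : ℝ) (h0 : 0 < t) (h1 : t ≤ 1) :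
    ((Finset.univ.filter (fun A : Finset (Fin s) => A.card ≤ d)).card : ℝ) * t ^ d
      ≤ (1 + t) ^ s := by
  have h := Finset.sum_pow_mul_eq_add_pow t 1 (Finset.univ : Finset (Fin s))
  simp only [one_pow, mul_one, Finset.powerset_univ, Finset.card_univ, Fintype.card_fin] at h
  rw [add_comm, ← h, ← nsmul_eq_mul]
  refine (Finset.card_nsmul_le_sum _ (fun A : Finset (Fin s) => t ^ A.card) _ ?_).trans
    (Finset.sum_le_sum_of_subset_of_nonneg (Finset.filter_subset _ _) fun _ _ _ => by positivity)
  intro A hA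
  exact pow_le_pow_of_le_one h0.le h1 (by simpa using hA)

lemma choose_lower (m n : ℕ) (hn : 1 ≤ n) (hmn : 900 * n ≤ m) :
    ((899 / 900 : ℝ) * m / n) ^ n ≤ (m.choose n : ℝ) := by
  have hn' : (0 : ℝ) < n := by exact_mod_cast hn
  have h1 : (((m + 1 - n : ℕ) : ℝ)) ^ n ≤ (n.factorial : ℝ) * m.choose n := by
    have := Nat.pow_sub_le_descFactorial m n
    rw [Nat.descFactorial_eq_factorial_mul_choose] at this
    exact_mod_cast this
  have h2 : (n.factorial : ℝ) ≤ (n : ℝ) ^ n := by exact_mod_cast Nat.factorial_le_pow n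
  have h3 : (899 / 900 : ℝ) * m ≤ ((m + 1 - n : ℕ) : ℝ) := by
    rw [Nat.cast_sub (by omega)]
    have : (900 : ℝ) * n ≤ m := by exact_mod_cast hmn
    push_cast
    linarith
  rw [div_pow, div_le_iff₀ (by positivity)]
  calc ((899 / 900 : ℝ) * m) ^ n ≤ (((m + 1 - n : ℕ) : ℝ)) ^ n := by gcongr
    _ ≤ (n.factorial : ℝ) * m.choose n := h1
    _ ≤ (n : ℝ) ^ n * m.choose n := by gcongr
    _ = _ := mul_comm _ _

/-- For all `m` and all `n` with `1 ≤ n ≤ m/900`, every non-adaptive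
`(m,n,s,3)`-scheme whose query function is `(x,y,z) ↦ 1 iff x+y+z = 1` (sum over the
integers) for every element satisfies `s ≥ (3/(5e))·√(mn)`. -/
theorem sum_eq_one_three_probe_lower_bound :
    ∀ m n s : ℕ, 1 ≤ n → (n : ℝ) ≤ (m : ℝ) / 900 →
    ∀ i₁ i₂ i₃ : Fin m → Fin s, ∀ φ : Finset (Fin m) → Fin s → Bool,
      (∀ S : Finset (Fin m), S.card ≤ n → ∀ x : Fin m,
        (((φ S (i₁ x)).toNat + (φ S (i₂ x)).toNat + (φ S (i₃ x)).toNat = 1) ↔ x ∈ S)) →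
      (3 / (5 * Real.exp 1)) * Real.sqrt ((m : ℝ) * (n : ℝ)) ≤ (s : ℝ) := by
  intro m n s hn hmn i₁ i₂ i₃ φ H
  have hn' : (0 : ℝ) < n := by exact_mod_cast hn
  have hmn' : (900 : ℝ) * n ≤ m := by linarith
  have hmnN : 900 * n ≤ m := by exact_mod_cast hmn'
  have hlow := choose_lower m n hn hmnN
  have hcount : (m.choose n : ℝ) ≤
      ((Finset.univ.filter (fun A : Finset (Fin s) => A.card ≤ 2 * n)).card : ℝ) := by
    exact_mod_cast choose_le_count m n s i₁ i₂ i₃ φ H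
  have hq : (899 : ℝ) ≤ (899 / 900 : ℝ) * m / n := by
    rw [le_div_iff₀ hn']; linarith
  rcases lt_or_ge s (2 * n) with hs | hs
  · exfalso
    have h1 := count_bound s (2 * n) 1 one_pos le_rfl
    have h2 : (1 + 1 : ℝ) ^ s ≤ (1 + 1 : ℝ) ^ (2 * n) :=
      pow_le_pow_right₀ (by norm_num) hs.le
    have h3 : (899 : ℝ) ^ n ≤ ((899 / 900 : ℝ) * m / n) ^ n := by gcongr
    have h4 : (1 + 1 : ℝ) ^ (2 * n) = 4 ^ n := by rw [pow_mul]; norm_num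
    have h5 : (4 : ℝ) ^ n < 899 ^ n := pow_lt_pow_left₀ (by norm_num) (by norm_num) (by omega)
    simp only [one_pow, mul_one] at h1
    linarith
  · have hsR : (2 : ℝ) * n ≤ s := by exact_mod_cast hs
    have hs0 : (0 : ℝ) < s := by linarith
    set t : ℝ := 2 * n / s with ht
    have ht0 : 0 < t := by positivity
    have ht1 : t ≤ 1 := by rw [ht, div_le_one hs0]; exact hsR
    have h1 := count_bound s (2 * n) t ht0 ht1
    have h2 : (1 + t) ^ s ≤ (Real.exp 1 ^ 2) ^ n := by
      have h3 : (1 + t) ^ s ≤ (Real.exp t) ^ s := by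
        gcongr
        linarith [Real.add_one_le_exp t]
      refine h3.trans (le_of_eq ?_)
      rw [← Real.exp_nat_mul, ← pow_mul, ← Real.exp_nat_mul]
      congr 1
      rw [ht]
      push_cast
      field_simp
    have h3 : ((899 / 900 : ℝ) * m / n * t ^ 2) ^ n ≤ (Real.exp 1 ^ 2) ^ n := by
      refine le_trans ?_ (h1.trans h2)
      rw [mul_pow, ← pow_mul]
      gcongr
      exact hlow.trans hcount
    have h4 := le_of_pow_le_pow_left₀ (by omega) (by positivity) h3
    have h5 : (899 / 900 : ℝ) * m / n * t ^ 2 = (899 / 225 : ℝ) * (m * n) / s ^ 2 := by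
      rw [ht]; field_simp; ring
    rw [h5, div_le_iff₀ (by positivity)] at h4
    have he : 0 < Real.exp 1 := Real.exp_pos 1
    have h6 : Real.sqrt ((m : ℝ) * n) ≤ (5 / 3) * (Real.exp 1 * s) := by
      apply Real.sqrt_le_iff.2
      refine ⟨by positivity, ?_⟩
      have : (0 : ℝ) ≤ m * n := by positivity
      nlinarith [sq_nonneg (Real.exp 1 * s)]
    calc 3 / (5 * Real.exp 1) * Real.sqrt ((m : ℝ) * n)
        ≤ 3 / (5 * Real.exp 1) * ((5 / 3) * (Real.exp 1 * s)) := by gcongr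
      _ = s := by field_simp
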